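/- arXiv:0704.1807 — 2 statements merged into one kernel-verified Lean document; each statement's English description precedes it below -/
import Mathlib

section
/- Let V be a real inner product space, let c be a real number, and let η₁,…,η_s be pairwise distinct vectors in V such that ⟨η_i, η_j⟩ = c for all i ≠ j. Then for all pairwise distinct indices i, j, k, the vectors η_i − η_k and η_j − η_k are linearly independent over ℝ. -/
open scoped RealInnerProductSpace

/-- Three distinct vectors with equal pairwise inner products are not collinear: a direction of
a common line would be orthogonal to all three of them, hence to itself. -/
theorem linearIndependent_sub_sub_of_inner_eq
    {V : Type*} [NormedAddCommGroup V] [InnerProductSpace ℝ V] {x y z : V} {c : ℝ}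
    (hxy : x ≠ y) (hyz : y ≠ z) (hxz : x ≠ z)
    (ixy : ⟪x, y⟫ = c) (iyz : ⟪y, z⟫ = c) (ixz : ⟪x, z⟫ = c) :
    LinearIndependent ℝ ![x - z, y - z] := by
  rw [LinearIndependent.pair_iff' (sub_ne_zero.2 hxz)]
  intro r hr
  have hr0 : r ≠ 0 := by
    rintro rfl
    exact hyz (sub_eq_zero.1 (by rw [← hr, zero_smul]))
  have hsub : (1 - r) • (x - z) = x - y := by
    rw [sub_smul, one_smul, hr, sub_sub_sub_cancel_right]
  have hr1 : 1 - r ≠ 0 := by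
    intro h
    exact hxy (sub_eq_zero.1 (by rw [← hsub, h, zero_smul]))
  have hx : ⟪x - z, x⟫ = 0 := by
    refine (mul_eq_zero.1 ?_).resolve_left hr0
    rw [← real_inner_smul_left, hr, inner_sub_left, real_inner_comm, ixy,
      real_inner_comm, ixz, sub_self]
  have hz : ⟪x - z, z⟫ = 0 := by
    refine (mul_eq_zero.1 ?_).resolve_left hr1
    rw [← real_inner_smul_left, hsub, inner_sub_left, ixz, iyz, sub_self]
  refine sub_ne_zero.2 hxz (inner_self_eq_zero (𝕜 := ℝ).1 ?_)
  rw [inner_sub_right, hx, hz, sub_self]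

/-- Lemma 4.1(ii): if pairwise distinct vectors `η i` in a real inner product space satisfy
`⟪η i, η j⟫ = c` for all `i ≠ j`, then for pairwise distinct indices `i, j, k` the vectors
`η i - η k` and `η j - η k` are linearly independent over `ℝ`. -/
theorem principal_normal_differences_linearIndependent
    {V : Type*} [NormedAddCommGroup V] [InnerProductSpace ℝ V]
    {s : ℕ} (η : Fin s → V) (hη : Function.Injective η) (c : ℝ)
    (h : ∀ i j : Fin s, i ≠ j → ⟪η i, η j⟫ = c) :
    ∀ i j k : Fin s, i ≠ j → j ≠ k → i ≠ k →
      LinearIndependent ℝ ![η i - η k, η j - η k] := by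
  intro i j k hij hjk hik
  exact linearIndependent_sub_sub_of_inner_eq (hη.ne hij) (hη.ne hjk) (hη.ne hik)
    (h i j hij) (h j k hjk) (h i k hik)
end

section
/- Let G be a closed connected subgroup of the special orthogonal group SO(3), i.e., of the group of linear isometries of EuclideanSpace ℝ (Fin 3) with determinant 1 (equivalently, of 3×3 real orthogonal matrices of determinant 1). Then either there exists a nonzero vector v ∈ ℝ³ with g v = v for every g ∈ G, or G acts transitively on the unit sphere: for all u, v ∈ ℝ³ with ‖u‖ = ‖v‖ = 1 there exists g ∈ G with g u = v. -/
/-- The rotation of `ℝ³` by the angle `θ` about the first coordinate axis. -/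
noncomputable def axisRotation (θ : ℝ) : Matrix.orthogonalGroup (Fin 3) ℝ :=
  ⟨!![1, 0, 0; 0, Real.cos θ, -Real.sin θ; 0, Real.sin θ, Real.cos θ], by
    rw [Matrix.mem_orthogonalGroup_iff]
    ext i j
    fin_cases i <;> fin_cases j <;>
      simp [Matrix.mul_apply, Fin.sum_univ_three] <;>
      nlinarith [Real.sin_sq_add_cos_sq θ]⟩

theorem coe_axisRotation (θ : ℝ) : (axisRotation θ : Matrix (Fin 3) (Fin 3) ℝ) =
    !![1, 0, 0; 0, Real.cos θ, -Real.sin θ; 0, Real.sin θ, Real.cos θ] := rfl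

theorem axisRotation_add (θ φ : ℝ) :
    axisRotation (θ + φ) = axisRotation θ * axisRotation φ := by
  ext i j
  fin_cases i <;> fin_cases j <;>
    simp [coe_axisRotation, Matrix.mul_apply, Fin.sum_univ_three, Real.cos_add, Real.sin_add] <;>
    ring

theorem axisRotation_eq_one {θ : ℝ} (h : Real.cos θ = 1) : axisRotation θ = 1 := by
  have hs : Real.sin θ = 0 := by
    have := Real.sin_sq_add_cos_sq θ
    rw [h] at this
    exact pow_eq_zero_iff two_ne_zero |>.mp (by linarith)
  ext i j
  fin_cases i <;> fin_cases j <;> simp [coe_axisRotation, h, hs]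

theorem continuous_axisRotation : Continuous axisRotation := by
  refine Continuous.subtype_mk (continuous_matrix fun i j => ?_) _
  fin_cases i <;> fin_cases j <;> simp <;> fun_prop

theorem trace_axisRotation (θ : ℝ) :
    (axisRotation θ : Matrix (Fin 3) (Fin 3) ℝ).trace = 1 + 2 * Real.cos θ := by
  simp [coe_axisRotation, Matrix.trace, Fin.sum_univ_three]
  ring

namespace Matrix.orthogonalGroup

variable {n : Type*} [Fintype n] [DecidableEq n]

theorem mulVec_dotProduct_mulVec (A : orthogonalGroup n ℝ) (x y : n → ℝ) :
    (A : Matrix n n ℝ) *ᵥ x ⬝ᵥ (A : Matrix n n ℝ) *ᵥ y = x ⬝ᵥ y := by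
  have h : (A : Matrix n n ℝ)ᵀ * (A : Matrix n n ℝ) = 1 := (mem_orthogonalGroup_iff' n ℝ).1 A.2
  rw [dotProduct_mulVec, ← mulVec_transpose, mulVec_mulVec, h, one_mulVec]

theorem inv_mulVec_mulVec (A : orthogonalGroup n ℝ) (x : n → ℝ) :
    ((A⁻¹ : orthogonalGroup n ℝ) : Matrix n n ℝ) *ᵥ (A : Matrix n n ℝ) *ᵥ x = x := by
  rw [mulVec_mulVec, ← Submonoid.coe_mul, inv_mul_cancel, OneMemClass.coe_one, one_mulVec]

theorem mulVec_inv_mulVec (A : orthogonalGroup n ℝ) (x : n → ℝ) :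
    (A : Matrix n n ℝ) *ᵥ ((A⁻¹ : orthogonalGroup n ℝ) : Matrix n n ℝ) *ᵥ x = x := by
  rw [mulVec_mulVec, ← Submonoid.coe_mul, mul_inv_cancel, OneMemClass.coe_one, one_mulVec]

theorem trace_conj (P A : orthogonalGroup n ℝ) :
    ((P * A * P⁻¹ : orthogonalGroup n ℝ) : Matrix n n ℝ).trace = (A : Matrix n n ℝ).trace := by
  rw [Submonoid.coe_mul, trace_mul_comm, ← Submonoid.coe_mul, ← mul_assoc, inv_mul_cancel, one_mul]

theorem exists_mulVec_single_eq (i : n) {u : n → ℝ} (hu : u ⬝ᵥ u = 1) :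
    ∃ P : orthogonalGroup n ℝ, (P : Matrix n n ℝ) *ᵥ Pi.single i 1 = u := by
  have hv : Orthonormal ℝ (({i} : Set n).domRestrict fun _ => WithLp.toLp 2 u) := by
    refine ⟨fun _ => ?_, fun a b hab => (hab (Subsingleton.elim a b)).elim⟩
    have h : ‖WithLp.toLp 2 u‖ ^ 2 = 1 := by
      rw [← real_inner_self_eq_norm_sq]
      exact hu
    exact (pow_eq_one_iff_of_nonneg (norm_nonneg _) two_ne_zero).1 h
  obtain ⟨b, hb⟩ := hv.exists_orthonormalBasis_extension_of_card_eq (by simp)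
  refine ⟨⟨_, (EuclideanSpace.basisFun n ℝ).toMatrix_orthonormalBasis_mem_orthogonal b⟩, ?_⟩
  ext j
  simp [Module.Basis.toMatrix_apply, hb i rfl]

theorem det_conj (P A : orthogonalGroup n ℝ) :
    ((P⁻¹ * A * P : orthogonalGroup n ℝ) : Matrix n n ℝ).det = (A : Matrix n n ℝ).det := by
  rw [Submonoid.coe_mul, det_mul_comm, ← Submonoid.coe_mul, ← mul_assoc, mul_inv_cancel, one_mul]

/-- Every rotation of `ℝ³` has an axis. -/
theorem exists_mulVec_eq_self (A : orthogonalGroup (Fin 3) ℝ)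
    (hA : (A : Matrix (Fin 3) (Fin 3) ℝ).det = 1) :
    ∃ u : Fin 3 → ℝ, u ⬝ᵥ u = 1 ∧ (A : Matrix (Fin 3) (Fin 3) ℝ) *ᵥ u = u := by
  obtain ⟨M, hM⟩ := A
  have h : M * Mᵀ = 1 := (mem_orthogonalGroup_iff _ ℝ).1 hM
  have hdet : (M - 1).det = 0 := by
    have h1 : M - 1 = M * (-(M - 1)ᵀ) := by
      simp [mul_sub, h]
    have h2 := congrArg det h1
    rw [det_mul, det_neg, det_transpose, hA] at h2
    norm_num at h2
    linarith
  obtain ⟨v, hv, hMv⟩ := exists_mulVec_eq_zero_iff.2 hdet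
  rw [sub_mulVec, one_mulVec, sub_eq_zero] at hMv
  have hpos : 0 < v ⬝ᵥ v := lt_of_le_of_ne (by simpa using dotProduct_star_self_nonneg v)
    (Ne.symm (by simpa using hv))
  refine ⟨(√(v ⬝ᵥ v))⁻¹ • v, ?_, by rw [mulVec_smul, hMv]⟩
  rw [smul_dotProduct, dotProduct_smul, smul_smul, smul_eq_mul, ← mul_inv,
    Real.mul_self_sqrt hpos.le, inv_mul_cancel₀ hpos.ne']

theorem eq_axisRotation (A : orthogonalGroup (Fin 3) ℝ)
    (hA : (A : Matrix (Fin 3) (Fin 3) ℝ).det = 1)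
    (h0 : (A : Matrix (Fin 3) (Fin 3) ℝ) *ᵥ Pi.single 0 1 = Pi.single 0 1) :
    ∃ θ : ℝ, A = axisRotation θ := by
  have h0' : ((A⁻¹ : orthogonalGroup (Fin 3) ℝ) : Matrix (Fin 3) (Fin 3) ℝ) *ᵥ Pi.single 0 1 =
      Pi.single 0 1 := by
    conv_lhs => rw [← h0]
    exact inv_mulVec_mulVec A _
  obtain ⟨M, hM⟩ := A
  have hinv : (((⟨M, hM⟩ : orthogonalGroup (Fin 3) ℝ)⁻¹ : orthogonalGroup (Fin 3) ℝ) :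
    Matrix (Fin 3) (Fin 3) ℝ) = Mᵀ := rfl
  rw [hinv] at h0'
  have horth : Mᵀ * M = 1 := (mem_orthogonalGroup_iff' _ ℝ).1 hM
  have hc (i) := congrFun h0 i
  have hr (i) := congrFun h0' i
  have ho (i j) := congrFun (congrFun horth i) j
  have hc0 := hc 0
  have hc1 := hc 1
  have hc2 := hc 2
  have hr1 := hr 1
  have hr2 := hr 2
  have ho11 := ho 1 1
  have ho12 := ho 1 2
  have ho22 := ho 2 2
  simp [mul_apply, Fin.sum_univ_three] at hc0 hc1 hc2 hr1 hr2 ho11 ho12 ho22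
  simp only [hr1, hr2] at ho11 ho12 ho22
  simp [det_fin_three, hc0, hc1, hc2] at hA
  have hd : M 2 2 = M 1 1 := by linear_combination M 2 1 * ho12 + M 1 1 * hA - M 2 2 * ho11
  have hb : M 1 2 = - M 2 1 := by linear_combination M 1 1 * ho12 - M 2 1 * hA - M 1 2 * ho11
  let z : ℂ := ⟨M 1 1, M 2 1⟩
  have hz : ‖z‖ = 1 := by
    have : ‖z‖ ^ 2 = 1 := by
      rw [← Complex.normSq_eq_norm_sq, Complex.normSq_mk]
      linarith
    exact (pow_eq_one_iff_of_nonneg (norm_nonneg _) two_ne_zero).1 this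
  have hz0 : z ≠ 0 := by
    intro h
    simp [h] at hz
  have hcos : Real.cos z.arg = M 1 1 := by rw [Complex.cos_arg hz0, hz, div_one]
  have hsin : Real.sin z.arg = M 2 1 := by rw [Complex.sin_arg, hz, div_one]
  refine ⟨z.arg, ?_⟩
  ext i j
  fin_cases i <;> fin_cases j <;> simp [coe_axisRotation, *]

/-- Every rotation of `ℝ³` is conjugate to a rotation about the first coordinate axis. -/
theorem exists_eq_conj_axisRotation (A : orthogonalGroup (Fin 3) ℝ)
    (hA : (A : Matrix (Fin 3) (Fin 3) ℝ).det = 1) :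
    ∃ (P : orthogonalGroup (Fin 3) ℝ) (θ : ℝ), A = P * axisRotation θ * P⁻¹ := by
  obtain ⟨u, hu, hAu⟩ := exists_mulVec_eq_self A hA
  obtain ⟨P, hP⟩ := exists_mulVec_single_eq (0 : Fin 3) hu
  obtain ⟨θ, hθ⟩ := eq_axisRotation (P⁻¹ * A * P) (by rw [det_conj, hA]) (by
    rw [Submonoid.coe_mul, Submonoid.coe_mul, ← mulVec_mulVec, ← mulVec_mulVec, hP, hAu, ← hP,
      inv_mulVec_mulVec])
  exact ⟨P, θ, by rw [← hθ]; group⟩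

/-- A closed subgroup containing a rotation by an irrational angle contains all rotations about
the same axis. -/
theorem conj_axisRotation_mem {G : Subgroup (orthogonalGroup (Fin 3) ℝ)}
    (hG : IsClosed (G : Set (orthogonalGroup (Fin 3) ℝ))) {P : orthogonalGroup (Fin 3) ℝ} {θ : ℝ}
    (hθ : Irrational (θ / (2 * Real.pi))) (hmem : P * axisRotation θ * P⁻¹ ∈ G) (φ : ℝ) :
    P * axisRotation φ * P⁻¹ ∈ G := by
  have hzero : axisRotation 0 = 1 := axisRotation_eq_one Real.cos_zero
  have hsub : (AddSubgroup.closure {θ, 2 * Real.pi} : Set ℝ) ⊆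
      {φ | P * axisRotation φ * P⁻¹ ∈ G} := by
    intro φ hφ
    induction hφ using AddSubgroup.closure_induction with
    | mem x hx =>
      rcases hx with rfl | rfl
      · exact hmem
      · simp [axisRotation_eq_one Real.cos_two_pi]
    | zero => simp [hzero]
    | add x y _ _ hx hy =>
      have : P * axisRotation (x + y) * P⁻¹ =
          (P * axisRotation x * P⁻¹) * (P * axisRotation y * P⁻¹) := by
        rw [axisRotation_add]
        group
      rw [Set.mem_ofPred_eq, this]
      exact G.mul_mem hx hy
    | neg x _ hx =>
      have hinv : axisRotation (-x) = (axisRotation x)⁻¹ := by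
        rw [eq_inv_iff_mul_eq_one, ← axisRotation_add, neg_add_cancel, hzero]
      have : P * axisRotation (-x) * P⁻¹ = (P * axisRotation x * P⁻¹)⁻¹ := by
        rw [hinv]
        group
      rw [Set.mem_ofPred_eq, this]
      exact G.inv_mem hx
  have hcl : IsClosed {φ | P * axisRotation φ * P⁻¹ ∈ G} :=
    hG.preimage ((continuous_const.mul continuous_axisRotation).mul continuous_const)
  exact hcl.closure_subset_iff.2 hsub (dense_addSubgroupClosure_pair_iff.2 hθ φ)

theorem exists_axisRotation_mulVec_eq {x y : Fin 3 → ℝ} (hxy : x ⬝ᵥ x = y ⬝ᵥ y)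
    (h0 : x 0 = y 0) :
    ∃ φ : ℝ, (axisRotation φ : Matrix (Fin 3) (Fin 3) ℝ) *ᵥ x = y := by
  let z : ℂ := ⟨x 1, x 2⟩
  let w : ℂ := ⟨y 1, y 2⟩
  have hzw : ‖w‖ = ‖z‖ := by
    have : ‖w‖ ^ 2 = ‖z‖ ^ 2 := by
      rw [← Complex.normSq_eq_norm_sq, ← Complex.normSq_eq_norm_sq, Complex.normSq_mk,
        Complex.normSq_mk]
      simp only [dotProduct, Fin.sum_univ_three, h0] at hxy
      linarith
    exact (sq_eq_sq₀ (norm_nonneg _) (norm_nonneg _)).1 this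
  have h : Complex.exp ((w.arg - z.arg : ℝ) * Complex.I) * z = w := by
    calc Complex.exp ((w.arg - z.arg : ℝ) * Complex.I) * z
        = Complex.exp ((w.arg - z.arg : ℝ) * Complex.I) *
            (‖z‖ * Complex.exp (z.arg * Complex.I)) := by rw [Complex.norm_mul_exp_arg_mul_I]
      _ = ‖w‖ * Complex.exp (w.arg * Complex.I) := by
        rw [mul_left_comm, ← Complex.exp_add, hzw]
        push_cast
        ring_nf
      _ = w := Complex.norm_mul_exp_arg_mul_I w
  have hre := congrArg Complex.re h
  have him := congrArg Complex.im h
  rw [Complex.mul_re, Complex.exp_ofReal_mul_I_re, Complex.exp_ofReal_mul_I_im] at hre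
  rw [Complex.mul_im, Complex.exp_ofReal_mul_I_re, Complex.exp_ofReal_mul_I_im] at him
  refine ⟨w.arg - z.arg, ?_⟩
  ext i
  fin_cases i
  · simpa [coe_axisRotation, mulVec, dotProduct, Fin.sum_univ_three] using h0
  · simpa [coe_axisRotation, mulVec, dotProduct, Fin.sum_univ_three, sub_eq_add_neg] using hre
  · simpa [coe_axisRotation, mulVec, dotProduct, Fin.sum_univ_three, add_comm] using him

/-- The rotations about an axis act transitively on the circles of latitude. -/
theorem exists_conj_axisRotation_mulVec_eq (P : orthogonalGroup (Fin 3) ℝ) {x y : Fin 3 → ℝ}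
    (hxy : x ⬝ᵥ x = y ⬝ᵥ y)
    (h0 : x ⬝ᵥ (P : Matrix (Fin 3) (Fin 3) ℝ) *ᵥ Pi.single 0 1 =
      y ⬝ᵥ (P : Matrix (Fin 3) (Fin 3) ℝ) *ᵥ Pi.single 0 1) :
    ∃ φ : ℝ, ((P * axisRotation φ * P⁻¹ : orthogonalGroup (Fin 3) ℝ) :
      Matrix (Fin 3) (Fin 3) ℝ) *ᵥ x = y := by
  have key (v : Fin 3 → ℝ) :
      (((P⁻¹ : orthogonalGroup (Fin 3) ℝ) : Matrix (Fin 3) (Fin 3) ℝ) *ᵥ v) 0 =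
        v ⬝ᵥ (P : Matrix (Fin 3) (Fin 3) ℝ) *ᵥ Pi.single 0 1 := by
    rw [← mulVec_dotProduct_mulVec P⁻¹, inv_mulVec_mulVec, dotProduct_single_one]
  obtain ⟨φ, hφ⟩ := exists_axisRotation_mulVec_eq
    (x := ((P⁻¹ : orthogonalGroup (Fin 3) ℝ) : Matrix (Fin 3) (Fin 3) ℝ) *ᵥ x)
    (y := ((P⁻¹ : orthogonalGroup (Fin 3) ℝ) : Matrix (Fin 3) (Fin 3) ℝ) *ᵥ y)
    (by rw [mulVec_dotProduct_mulVec, mulVec_dotProduct_mulVec, hxy])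
    (by rw [key, key, h0])
  refine ⟨φ, ?_⟩
  rw [Submonoid.coe_mul, Submonoid.coe_mul, ← mulVec_mulVec, ← mulVec_mulVec, hφ,
    mulVec_inv_mulVec]

/-- If a group of isometries moves the unit vector `u` to every unit vector of a cap around `u`,
then every unit vector lies in the orbit of `u`. -/
theorem exists_mulVec_eq_of_cap {G : Subgroup (orthogonalGroup (Fin 3) ℝ)} {u : Fin 3 → ℝ}
    (hu : u ⬝ᵥ u = 1) {a : ℝ} (ha : a < 1)
    (hcap : ∀ x : Fin 3 → ℝ, x ⬝ᵥ x = 1 → a < x ⬝ᵥ u →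
      ∃ g ∈ G, (g : Matrix (Fin 3) (Fin 3) ℝ) *ᵥ u = x)
    {x : Fin 3 → ℝ} (hx : x ⬝ᵥ x = 1) :
    ∃ g ∈ G, (g : Matrix (Fin 3) (Fin 3) ℝ) *ᵥ u = x := by
  let O : Set (EuclideanSpace ℝ (Fin 3)) :=
    {z | ∃ g ∈ G, (g : Matrix (Fin 3) (Fin 3) ℝ) *ᵥ u = z.ofLp}
  have hstep {y z : EuclideanSpace ℝ (Fin 3)} (hz : ‖z‖ = 1) (hyz : a < inner ℝ y z)
      (hy : y ∈ O) : z ∈ O := by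
    obtain ⟨g, hg, hgy⟩ := hy
    obtain ⟨k, hk, hkz⟩ := hcap (((g⁻¹ : orthogonalGroup (Fin 3) ℝ) :
        Matrix (Fin 3) (Fin 3) ℝ) *ᵥ z.ofLp)
      (by
        rw [mulVec_dotProduct_mulVec]
        have := real_inner_self_eq_norm_sq z
        rw [hz, one_pow] at this
        exact this)
      (by
        rw [← mulVec_dotProduct_mulVec g, mulVec_inv_mulVec, hgy]
        exact hyz)
    refine ⟨g * k, G.mul_mem hg hk, ?_⟩
    rw [Submonoid.coe_mul, ← mulVec_mulVec, hkz, mulVec_inv_mulVec]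
  have hnorm {v : Fin 3 → ℝ} (hv : v ⬝ᵥ v = 1) :
      WithLp.toLp 2 v ∈ Metric.sphere (0 : EuclideanSpace ℝ (Fin 3)) 1 := by
    have h : ‖WithLp.toLp 2 v‖ ^ 2 = 1 := by
      rw [← real_inner_self_eq_norm_sq]
      exact hv
    rw [mem_sphere_zero_iff_norm]
    exact (pow_eq_one_iff_of_nonneg (norm_nonneg _) two_ne_zero).1 h
  have hsphere : IsPreconnected (Metric.sphere (0 : EuclideanSpace ℝ (Fin 3)) 1) := by
    refine isPreconnected_sphere ?_ _ _
    rw [← Module.finrank_eq_rank, finrank_euclideanSpace_fin]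
    norm_num
  refine hsphere.induction₂' (fun y z => y ∈ O → z ∈ O) (fun y hy => ?_)
    (fun _ _ _ _ _ _ h1 h2 h => h2 (h1 h)) (hnorm hu) (hnorm hx)
    ⟨1, G.one_mem, by simp⟩
  rw [mem_sphere_zero_iff_norm] at hy
  have hcont : ∀ᶠ z in nhds y, a < inner ℝ y z := by
    refine continuousAt_const.eventually_lt (f := fun _ => a) (by fun_prop) ?_
    rw [real_inner_self_eq_norm_sq, hy, one_pow]
    exact ha
  filter_upwards [self_mem_nhdsWithin, nhdsWithin_le_nhds hcont] with z hz hyz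
  rw [mem_sphere_zero_iff_norm] at hz
  exact ⟨hstep hz hyz, hstep hy (by rwa [real_inner_comm])⟩

theorem continuous_mulVec_dotProduct (u : n → ℝ) :
    Continuous fun g : orthogonalGroup n ℝ => (g : Matrix n n ℝ) *ᵥ u ⬝ᵥ u :=
  (continuous_subtype_val.matrix_mulVec continuous_const).dotProduct continuous_const

/-- A connected group of isometries that is transitive on the circles of latitude around `u`
either fixes `u` or is transitive on the unit sphere. -/
theorem fixes_or_transitive {G : Subgroup (orthogonalGroup (Fin 3) ℝ)}
    (hconn : IsPreconnected (G : Set (orthogonalGroup (Fin 3) ℝ))) {u : Fin 3 → ℝ}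
    (hu : u ⬝ᵥ u = 1)
    (hlat : ∀ x y : Fin 3 → ℝ, x ⬝ᵥ x = y ⬝ᵥ y → x ⬝ᵥ u = y ⬝ᵥ u →
      ∃ g ∈ G, (g : Matrix (Fin 3) (Fin 3) ℝ) *ᵥ x = y) :
    (∀ g ∈ G, (g : Matrix (Fin 3) (Fin 3) ℝ) *ᵥ u = u) ∨
    ∀ x : Fin 3 → ℝ, x ⬝ᵥ x = 1 → ∃ g ∈ G, (g : Matrix (Fin 3) (Fin 3) ℝ) *ᵥ u = x := by
  have hsub {x : Fin 3 → ℝ} (hx : x ⬝ᵥ x = 1) :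
      (x - u) ⬝ᵥ (x - u) = 2 - 2 * (x ⬝ᵥ u) := by
    rw [sub_dotProduct, dotProduct_sub, dotProduct_sub, hx, hu, dotProduct_comm u x]
    ring
  have hnonneg (v : Fin 3 → ℝ) : 0 ≤ v ⬝ᵥ v := by simpa using dotProduct_star_self_nonneg v
  by_cases hfix : ∀ g ∈ G, 1 ≤ (g : Matrix (Fin 3) (Fin 3) ℝ) *ᵥ u ⬝ᵥ u
  · left
    intro g hg
    have hgu := (mulVec_dotProduct_mulVec g u u).trans hu
    have h1 := hsub hgu
    have h2 := hnonneg ((g : Matrix (Fin 3) (Fin 3) ℝ) *ᵥ u - u)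
    rw [← sub_eq_zero, ← dotProduct_self_eq_zero]
    linarith [hfix g hg]
  · right
    push Not at hfix
    obtain ⟨g, hg, hlt⟩ := hfix
    intro x hx
    refine exists_mulVec_eq_of_cap hu hlt (fun y hy hay => ?_) hx
    have hle : y ⬝ᵥ u ≤ 1 := by linarith [hsub hy, hnonneg (y - u)]
    obtain ⟨k, hk, hky⟩ := hconn.intermediate_value hg G.one_mem
      (continuous_mulVec_dotProduct u).continuousOn
      ⟨hay.le, by rwa [OneMemClass.coe_one, one_mulVec, hu]⟩
    obtain ⟨r, hr, hry⟩ := hlat ((k : Matrix (Fin 3) (Fin 3) ℝ) *ᵥ u) y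
      (by rw [mulVec_dotProduct_mulVec, hu, hy]) hky
    exact ⟨r * k, G.mul_mem hr hk, by rw [Submonoid.coe_mul, ← mulVec_mulVec, hry]⟩

/-- A nontrivial connected group of rotations contains a rotation by an irrational angle. -/
theorem exists_irrational_conj_axisRotation_mem {G : Subgroup (orthogonalGroup (Fin 3) ℝ)}
    (hdet : ∀ g ∈ G, (g : Matrix (Fin 3) (Fin 3) ℝ).det = 1)
    (hconn : IsPreconnected (G : Set (orthogonalGroup (Fin 3) ℝ))) (hG : G ≠ ⊥) :
    ∃ (P : orthogonalGroup (Fin 3) ℝ) (θ : ℝ), Irrational (θ / (2 * Real.pi)) ∧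
      P * axisRotation θ * P⁻¹ ∈ G := by
  obtain ⟨g, hg, hg1⟩ := G.bot_or_exists_ne_one.resolve_left hG
  obtain ⟨P, θ, rfl⟩ := exists_eq_conj_axisRotation g (hdet g hg)
  have hθ : Real.cos θ < 1 := by
    refine lt_of_le_of_ne (Real.cos_le_one θ) fun h => hg1 ?_
    rw [axisRotation_eq_one h, mul_one, mul_inv_cancel]
  have hev : ∀ᶠ r in nhds (0 : ℝ), Real.cos θ < Real.cos (2 * Real.pi * r) :=
    continuousAt_const.eventually_lt (f := fun _ => Real.cos θ) (by fun_prop) (by simpa using hθ)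
  obtain ⟨δ, hδ, hball⟩ := Metric.eventually_nhds_iff.1 hev
  obtain ⟨r, hr, hr0, hrδ⟩ := exists_irrational_btwn hδ
  have hcos := hball (y := r) (by rwa [Real.dist_eq, sub_zero, abs_of_pos hr0])
  have hmem : 1 + 2 * Real.cos (2 * Real.pi * r) ∈ Set.Icc
      ((P * axisRotation θ * P⁻¹ : orthogonalGroup (Fin 3) ℝ) : Matrix (Fin 3) (Fin 3) ℝ).trace
      ((1 : orthogonalGroup (Fin 3) ℝ) : Matrix (Fin 3) (Fin 3) ℝ).trace := by
    rw [trace_conj, trace_axisRotation, OneMemClass.coe_one, trace_one, Fintype.card_fin]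
    push_cast
    constructor <;> linarith [Real.cos_le_one (2 * Real.pi * r)]
  obtain ⟨h, hh, htr⟩ := hconn.intermediate_value hg G.one_mem
    (f := fun g : orthogonalGroup (Fin 3) ℝ => (g : Matrix (Fin 3) (Fin 3) ℝ).trace)
    continuous_subtype_val.matrix_trace.continuousOn hmem
  obtain ⟨Q, ψ, rfl⟩ := exists_eq_conj_axisRotation h (hdet h hh)
  refine ⟨Q, ψ, ?_, hh⟩
  have heq : Real.cos (2 * Real.pi * r) = Real.cos ψ := by
    simp only [trace_conj, trace_axisRotation] at htr
    linarith
  have hpi := Real.pi_ne_zero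
  obtain ⟨k, rfl | rfl⟩ := Real.cos_eq_cos_iff.1 heq
  · rw [show (2 * k * Real.pi + 2 * Real.pi * r) / (2 * Real.pi) = k + r by field_simp]
    exact hr.intCast_add k
  · rw [show (2 * k * Real.pi - 2 * Real.pi * r) / (2 * Real.pi) = k - r by field_simp]
    exact hr.intCast_sub k

end Matrix.orthogonalGroup

/-- Dichotomy for closed connected subgroups of `SO(3)`: a closed connected subgroup `G` of the
orthogonal group of `ℝ³` all of whose elements have determinant `1` either fixes a nonzero
vector of `ℝ³` or acts transitively on the unit sphere. -/
theorem so3_closed_connected_subgroup_fixed_vector_or_transitive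
    (G : Subgroup (Matrix.orthogonalGroup (Fin 3) ℝ))
    (hdet : ∀ g : Matrix.orthogonalGroup (Fin 3) ℝ,
      g ∈ G → (g : Matrix (Fin 3) (Fin 3) ℝ).det = 1)
    (hclosed : IsClosed (G : Set (Matrix.orthogonalGroup (Fin 3) ℝ)))
    (hconn : IsConnected (G : Set (Matrix.orthogonalGroup (Fin 3) ℝ))) :
    (∃ v : EuclideanSpace ℝ (Fin 3), v ≠ 0 ∧ ∀ g ∈ G,
        Matrix.toEuclideanLin (g : Matrix (Fin 3) (Fin 3) ℝ) v = v) ∨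
    (∀ u v : EuclideanSpace ℝ (Fin 3), ‖u‖ = 1 → ‖v‖ = 1 →
        ∃ g ∈ G, Matrix.toEuclideanLin (g : Matrix (Fin 3) (Fin 3) ℝ) u = v) := by
  by_cases hG : G = ⊥
  · subst hG
    refine Or.inl ⟨EuclideanSpace.single 0 1, by simp, fun g hg => ?_⟩
    rw [Subgroup.mem_bot.1 hg, OneMemClass.coe_one, Matrix.toLpLin_apply, Matrix.one_mulVec]
  obtain ⟨P, θ, hθ, hmem⟩ :=
    Matrix.orthogonalGroup.exists_irrational_conj_axisRotation_mem hdet hconn.isPreconnected hG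
  set w : Fin 3 → ℝ := (P : Matrix (Fin 3) (Fin 3) ℝ).mulVec (Pi.single 0 1) with hw
  have hw1 : w ⬝ᵥ w = 1 := by
    rw [hw, Matrix.orthogonalGroup.mulVec_dotProduct_mulVec]
    simp
  have hunit {v : EuclideanSpace ℝ (Fin 3)} (hv : ‖v‖ = 1) : v.ofLp ⬝ᵥ v.ofLp = 1 := by
    have := real_inner_self_eq_norm_sq v
    rw [hv, one_pow] at this
    exact this
  rcases Matrix.orthogonalGroup.fixes_or_transitive hconn.isPreconnected hw1
    (fun x y hxy h0 =>
      (Matrix.orthogonalGroup.exists_conj_axisRotation_mulVec_eq P hxy h0).elim fun φ hφ =>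
        ⟨_, Matrix.orthogonalGroup.conj_axisRotation_mem hclosed hθ hmem φ, hφ⟩) with h | h
  · refine Or.inl ⟨WithLp.toLp 2 w, fun h0 => ?_, fun g hg => ?_⟩
    · rw [WithLp.toLp_eq_zero] at h0
      simp [h0] at hw1
    · rw [Matrix.toLpLin_toLp, Matrix.toLin'_apply, h g hg]
  · refine Or.inr fun u v hu hv => ?_
    obtain ⟨g, hg, hgu⟩ := h u.ofLp (hunit hu)
    obtain ⟨k, hk, hkv⟩ := h v.ofLp (hunit hv)
    refine ⟨k * g⁻¹, G.mul_mem hk (G.inv_mem hg), ?_⟩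
    rw [Matrix.toLpLin_apply, ← hgu, Submonoid.coe_mul, ← Matrix.mulVec_mulVec,
      Matrix.orthogonalGroup.inv_mulVec_mulVec, hkv]
end
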